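/- There is a bijection Φ from André permutations of the first kind of [n] to André permutations of the second kind of [n] which preserves the triple statistic (des, rminda, rmin): for every σ ∈ A_n^1, des(Φ(σ)) = des(σ), rminda(Φ(σ)) = rminda(σ), and rmin(Φ(σ)) = rmin(σ). -/

import Mathlib

open Finset
open scoped Classical
noncomputable section

def wrd {n : ℕ} (σ : Equiv.Perm (Fin n)) (i : ℕ) : ℕ :=
  if h : 1 ≤ i ∧ i ≤ n then ((σ ⟨i - 1, by omega⟩ : Fin n) : ℕ) + 1 else 0

def permDes {n : ℕ} (σ : Equiv.Perm (Fin n)) : ℕ :=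
  ((Finset.Icc 1 (n - 1)).filter fun i => wrd σ (i + 1) < wrd σ i).card

/-- number of right-to-left minima -/
def permRmin {n : ℕ} (σ : Equiv.Perm (Fin n)) : ℕ :=
  ((Finset.Icc 1 n).filter fun i => ∀ j ∈ Finset.Icc (i + 1) n, wrd σ i < wrd σ j).card

/-- number of positions which are simultaneously double ascents
(σ_{i−1} < σᵢ < σ_{i+1}, boundary convention σ₀ = σ_{n+1} = 0)
and right-to-left minima. -/
def permRminda {n : ℕ} (σ : Equiv.Perm (Fin n)) : ℕ :=
  ((Finset.Icc 1 n).filter fun i =>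
    (wrd σ (i - 1) < wrd σ i ∧ wrd σ i < wrd σ (i + 1)) ∧
      ∀ j ∈ Finset.Icc (i + 1) n, wrd σ i < wrd σ j).card

def lamB {n : ℕ} (σ : Equiv.Perm (Fin n)) (i : ℕ) : Finset ℕ :=
  (Finset.Icc 1 n).filter fun j => j < i ∧ ∀ l ∈ Finset.Ico j i, wrd σ i < wrd σ l

def rhoB {n : ℕ} (σ : Equiv.Perm (Fin n)) (i : ℕ) : Finset ℕ :=
  (Finset.Icc 1 n).filter fun j => i < j ∧ ∀ l ∈ Finset.Icc (i + 1) j, wrd σ i < wrd σ l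

def NoDd {n : ℕ} (σ : Equiv.Perm (Fin n)) : Prop :=
  ∀ i ∈ Finset.Icc 1 n, ¬(wrd σ i < wrd σ (i - 1) ∧ wrd σ (i + 1) < wrd σ i)

/-- André permutation of the first kind (x-factorization definition). -/
def IsAndreX1 {n : ℕ} (σ : Equiv.Perm (Fin n)) : Prop :=
  NoDd σ ∧ ∀ i ∈ Finset.Icc 1 n,
    (rhoB σ i = ∅ → lamB σ i = ∅) ∧
    (lamB σ i ≠ ∅ → rhoB σ i ≠ ∅ →
      ∃ b ∈ rhoB σ i, ∀ a ∈ lamB σ i, wrd σ a < wrd σ b)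

/-- André permutation of the second kind (x-factorization definition). -/
def IsAndreX2 {n : ℕ} (σ : Equiv.Perm (Fin n)) : Prop :=
  NoDd σ ∧ ∀ i ∈ Finset.Icc 1 n,
    (rhoB σ i = ∅ → lamB σ i = ∅) ∧
    (lamB σ i ≠ ∅ → rhoB σ i ≠ ∅ →
      ∃ b ∈ rhoB σ i, ∀ a ∈ lamB σ i, wrd σ b < wrd σ a)

/-- The value of a word at a position counted from `1`, and `0` outside of the word. -/
def letter (l : List ℕ) (i : ℕ) : ℕ := if i = 0 then 0 else l.getD (i - 1) 0

def wordDes (w : ℕ → ℕ) (n : ℕ) : ℕ :=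
  ((Finset.Icc 1 (n - 1)).filter fun i => w (i + 1) < w i).card

def wordRmin (w : ℕ → ℕ) (n : ℕ) : ℕ :=
  ((Finset.Icc 1 n).filter fun i => ∀ j ∈ Finset.Icc (i + 1) n, w i < w j).card

def wordRminda (w : ℕ → ℕ) (n : ℕ) : ℕ :=
  ((Finset.Icc 1 n).filter fun i =>
    (w (i - 1) < w i ∧ w i < w (i + 1)) ∧ ∀ j ∈ Finset.Icc (i + 1) n, w i < w j).card

/-- Position `a` belongs to the factor `λ` at position `i`. -/
def InLam (w : ℕ → ℕ) (i a : ℕ) : Prop :=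
  1 ≤ a ∧ a < i ∧ ∀ l, a ≤ l → l < i → w i < w l

/-- Position `b` belongs to the factor `ρ` at position `i`. -/
def InRho (w : ℕ → ℕ) (n i b : ℕ) : Prop :=
  i < b ∧ b ≤ n ∧ ∀ l, i < l → l ≤ b → w i < w l

/-- The André condition, with the relation `R` comparing the factors `λ` and `ρ`. -/
def WordAndre (R : ℕ → ℕ → Prop) (w : ℕ → ℕ) (n : ℕ) : Prop :=
  ∀ i, 1 ≤ i → i ≤ n → (∃ a, InLam w i a) →
    ∃ b, InRho w n i b ∧ ∀ a, InLam w i a → R (w a) (w b)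

/-- `w` is the concatenation of `wu` (length `k`), the smallest letter `m`, and
`wv` (length `k'`). -/
structure Glue (w wu wv : ℕ → ℕ) (k k' m : ℕ) : Prop where
  left : ∀ i ≤ k, w i = wu i
  mid : w (k + 1) = m
  right : ∀ j, 1 ≤ j → w (k + 1 + j) = wv j
  lt_left : ∀ i, 1 ≤ i → i ≤ k → m < wu i
  lt_right : ∀ j, 1 ≤ j → j ≤ k' → m < wv j
  left_zero : wu 0 = 0
  right_zero : wv 0 = 0
  right_end : wv (k' + 1) = 0

theorem card_filter_congr_of_mem {s : Finset ℕ} {P Q : ℕ → Prop} {_ : DecidablePred P}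
    {_ : DecidablePred Q} (h : ∀ i ∈ s, P i ↔ Q i) : (s.filter P).card = (s.filter Q).card :=
  congrArg Finset.card (Finset.filter_congr h)

theorem card_filter_eq_zero_of_mem {s : Finset ℕ} {P : ℕ → Prop} {_ : DecidablePred P}
    (h : ∀ i ∈ s, ¬ P i) : (s.filter P).card = 0 := by
  rw [Finset.filter_false_of_mem h, Finset.card_empty]

theorem card_filter_Icc_add (P : ℕ → Prop) {_ : DecidablePred P} (k k' : ℕ) :
    ((Finset.Icc 1 (k + 1 + k')).filter P).card =
      ((Finset.Icc 1 k).filter P).card + (if P (k + 1) then 1 else 0) +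
        ((Finset.Icc 1 k').filter fun j => P (k + 1 + j)).card := by
  simp only [Finset.card_filter]
  induction k' with
  | zero => rw [add_zero, Finset.sum_Icc_succ_top (by omega)]; rfl
  | succ k' ih =>
    rw [← add_assoc, Finset.sum_Icc_succ_top (by omega), ih, Finset.sum_Icc_succ_top (by omega)]
    simp only [add_assoc]

theorem wordDes_eq (w : ℕ → ℕ) (n : ℕ) (h0 : w 0 = 0) :
    wordDes w n = ((Finset.Icc 1 n).filter fun i => w i < w (i - 1)).card := by
  cases n with
  | zero => simp [wordDes]
  | succ n =>
    rw [show n + 1 = 0 + 1 + n by omega, card_filter_Icc_add]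
    simp [wordDes, h0, add_comm]

theorem Glue.wordDes {w wu wv : ℕ → ℕ} {k k' m : ℕ} (h : Glue w wu wv k k' m) :
    wordDes w (k + 1 + k') = wordDes wu k + (if k = 0 then 0 else 1) + wordDes wv k' := by
  have h0 : w 0 = 0 := by rw [h.left 0 (by omega), h.left_zero]
  rw [wordDes_eq w _ h0, wordDes_eq wu _ h.left_zero, wordDes_eq wv _ h.right_zero,
    card_filter_Icc_add]
  congr 1
  · congr 1
    · apply card_filter_congr_of_mem
      intro i hi
      rw [Finset.mem_Icc] at hi
      rw [h.left i hi.2, h.left (i - 1) (by omega)]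
    · rw [Nat.add_sub_cancel, h.mid, h.left k le_rfl]
      by_cases hk : k = 0
      · simp [hk, h.left_zero]
      · simp [hk, h.lt_left k (by omega) le_rfl]
  · apply card_filter_congr_of_mem
    intro j hj
    rw [Finset.mem_Icc] at hj
    rw [h.right j hj.1]
    by_cases h1 : j = 1
    · subst h1
      have := h.lt_right 1 le_rfl hj.2
      simp [h.mid, h.right_zero]
      omega
    · rw [show k + 1 + j - 1 = k + 1 + (j - 1) by omega, h.right (j - 1) (by omega)]

theorem Glue.rmin_left {w wu wv : ℕ → ℕ} {k k' m : ℕ} (h : Glue w wu wv k k' m) {i : ℕ}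
    (h1 : 1 ≤ i) (hi : i ≤ k) : ¬ ∀ j ∈ Finset.Icc (i + 1) (k + 1 + k'), w i < w j := by
  intro hj
  have := hj (k + 1) (by simp; omega)
  rw [h.mid, h.left i hi] at this
  have := h.lt_left i h1 hi
  omega

theorem Glue.rmin_mid {w wu wv : ℕ → ℕ} {k k' m : ℕ} (h : Glue w wu wv k k' m) :
    ∀ j ∈ Finset.Icc (k + 1 + 1) (k + 1 + k'), w (k + 1) < w j := by
  intro j hj
  rw [Finset.mem_Icc] at hj
  obtain ⟨j, rfl⟩ := Nat.exists_eq_add_of_le (show k + 1 ≤ j by omega)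
  rw [h.mid, h.right j (by omega)]
  exact h.lt_right j (by omega) (by omega)

theorem Glue.rmin_right {w wu wv : ℕ → ℕ} {k k' m : ℕ} (h : Glue w wu wv k k' m) {i : ℕ}
    (h1 : 1 ≤ i) : (∀ j ∈ Finset.Icc (k + 1 + i + 1) (k + 1 + k'), w (k + 1 + i) < w j) ↔
      ∀ j ∈ Finset.Icc (i + 1) k', wv i < wv j := by
  rw [h.right i h1]
  simp only [Finset.mem_Icc]
  constructor
  · intro H j hj
    have := H (k + 1 + j) (by omega)
    rwa [h.right j (by omega)] at this
  · intro H j hj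
    obtain ⟨j, rfl⟩ := Nat.exists_eq_add_of_le (show k + 1 ≤ j by omega)
    rw [h.right j (by omega)]
    exact H j (by omega)

theorem Glue.wordRmin {w wu wv : ℕ → ℕ} {k k' m : ℕ} (h : Glue w wu wv k k' m) :
    wordRmin w (k + 1 + k') = 1 + wordRmin wv k' := by
  unfold _root_.wordRmin
  rw [card_filter_Icc_add, if_pos h.rmin_mid, card_filter_eq_zero_of_mem, zero_add]
  · congr 1
    apply card_filter_congr_of_mem
    intro i hi
    exact h.rmin_right (Finset.mem_Icc.1 hi).1
  · intro i hi
    rw [Finset.mem_Icc] at hi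
    exact h.rmin_left hi.1 hi.2

theorem Glue.wordRminda {w wu wv : ℕ → ℕ} {k k' m : ℕ} (h : Glue w wu wv k k' m)
    (hm : 0 < m) :
    wordRminda w (k + 1 + k') = (if k = 0 ∧ k' ≠ 0 then 1 else 0) + wordRminda wv k' := by
  unfold _root_.wordRminda
  rw [card_filter_Icc_add, card_filter_eq_zero_of_mem, zero_add]
  · congr 1
    · congr 1
      rw [Nat.add_sub_cancel, h.mid, h.left k le_rfl, h.right 1 le_rfl, eq_iff_iff]
      constructor
      · rintro ⟨⟨ha, hb⟩, -⟩
        constructor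
        · by_contra hk
          have := h.lt_left k (by omega) le_rfl
          omega
        · rintro rfl
          have := h.right_end
          rw [zero_add] at this
          omega
      · rintro ⟨rfl, hk⟩
        refine ⟨⟨by rwa [h.left_zero], h.lt_right 1 le_rfl (by omega)⟩, ?_⟩
        have := h.rmin_mid
        rwa [h.mid] at this
    · apply card_filter_congr_of_mem
      intro i hi
      rw [Finset.mem_Icc] at hi
      rw [h.rmin_right hi.1, add_assoc (k + 1) i 1, h.right i hi.1, h.right (i + 1) (by omega)]
      by_cases h1 : i = 1
      · subst h1
        have := h.lt_right 1 le_rfl hi.2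
        have h' : 0 < wv 1 := by omega
        simp [h.mid, h.right_zero, this, h']
      · rw [show k + 1 + i - 1 = k + 1 + (i - 1) by omega, h.right (i - 1) (by omega)]
  · intro i hi
    rw [Finset.mem_Icc] at hi
    exact fun H => h.rmin_left hi.1 hi.2 H.2

theorem Glue.inLam_left {w wu wv : ℕ → ℕ} {k k' m : ℕ} (h : Glue w wu wv k k' m) {i : ℕ}
    (hi : i ≤ k) (a : ℕ) : InLam w i a ↔ InLam wu i a := by
  refine and_congr_right fun _ => and_congr_right fun _ => forall₃_congr fun l _ hl => ?_
  rw [h.left i hi, h.left l (by omega)]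

theorem Glue.inLam_mid {w wu wv : ℕ → ℕ} {k k' m : ℕ} (h : Glue w wu wv k k' m) (a : ℕ) :
    InLam w (k + 1) a ↔ 1 ≤ a ∧ a ≤ k := by
  constructor
  · rintro ⟨h1, h2, -⟩
    omega
  · rintro ⟨h1, h2⟩
    refine ⟨h1, by omega, fun l hl hl' => ?_⟩
    rw [h.mid, h.left l (by omega)]
    exact h.lt_left l (by omega) (by omega)

theorem Glue.inLam_right {w wu wv : ℕ → ℕ} {k k' m : ℕ} (h : Glue w wu wv k k' m) {i : ℕ}
    (h1 : 1 ≤ i) (hi : i ≤ k') (a : ℕ) :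
    InLam w (k + 1 + i) a ↔ ∃ a', a = k + 1 + a' ∧ InLam wv i a' := by
  constructor
  · rintro ⟨h2, h3, h4⟩
    have ha : k + 1 < a := by
      by_contra hc
      have := h4 (k + 1) (by omega) (by omega)
      rw [h.mid, h.right i h1] at this
      have := h.lt_right i h1 hi
      omega
    obtain ⟨a, rfl⟩ := Nat.exists_eq_add_of_le ha.le
    refine ⟨a, rfl, by omega, by omega, fun l hl hl' => ?_⟩
    have := h4 (k + 1 + l) (by omega) (by omega)
    rwa [h.right i h1, h.right l (by omega)] at this
  · rintro ⟨a, rfl, h2, h3, h4⟩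
    refine ⟨by omega, by omega, fun l hl hl' => ?_⟩
    obtain ⟨l, rfl⟩ := Nat.exists_eq_add_of_le (show k + 1 ≤ l by omega)
    rw [h.right i h1, h.right l (by omega)]
    exact h4 l (by omega) (by omega)

theorem Glue.inRho_left {w wu wv : ℕ → ℕ} {k k' m : ℕ} (h : Glue w wu wv k k' m) {i : ℕ}
    (h1 : 1 ≤ i) (hi : i ≤ k) (b : ℕ) : InRho w (k + 1 + k') i b ↔ InRho wu k i b := by
  constructor
  · rintro ⟨h2, h3, h4⟩
    have hb : b ≤ k := by
      by_contra hc
      have := h4 (k + 1) (by omega) (by omega)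
      rw [h.mid, h.left i hi] at this
      have := h.lt_left i h1 hi
      omega
    refine ⟨h2, hb, fun l hl hl' => ?_⟩
    have := h4 l hl hl'
    rwa [h.left i hi, h.left l (by omega)] at this
  · rintro ⟨h2, h3, h4⟩
    refine ⟨h2, by omega, fun l hl hl' => ?_⟩
    rw [h.left i hi, h.left l (by omega)]
    exact h4 l hl hl'

theorem Glue.inRho_mid {w wu wv : ℕ → ℕ} {k k' m : ℕ} (h : Glue w wu wv k k' m) (b : ℕ) :
    InRho w (k + 1 + k') (k + 1) b ↔ k + 1 < b ∧ b ≤ k + 1 + k' := by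
  refine ⟨fun H => ⟨H.1, H.2.1⟩, fun H => ⟨H.1, H.2, fun l hl hl' => ?_⟩⟩
  exact h.rmin_mid l (by simp; omega)

theorem Glue.inRho_right {w wu wv : ℕ → ℕ} {k k' m : ℕ} (h : Glue w wu wv k k' m) {i : ℕ}
    (h1 : 1 ≤ i) (b : ℕ) :
    InRho w (k + 1 + k') (k + 1 + i) b ↔ ∃ b', b = k + 1 + b' ∧ InRho wv k' i b' := by
  constructor
  · rintro ⟨h2, h3, h4⟩
    obtain ⟨b, rfl⟩ := Nat.exists_eq_add_of_le (show k + 1 ≤ b by omega)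
    refine ⟨b, rfl, by omega, by omega, fun l hl hl' => ?_⟩
    have := h4 (k + 1 + l) (by omega) (by omega)
    rwa [h.right i h1, h.right l (by omega)] at this
  · rintro ⟨b, rfl, h2, h3, h4⟩
    refine ⟨by omega, by omega, fun l hl hl' => ?_⟩
    obtain ⟨l, rfl⟩ := Nat.exists_eq_add_of_le (show k + 1 ≤ l by omega)
    rw [h.right i h1, h.right l (by omega)]
    exact h4 l (by omega) (by omega)

theorem Glue.wordAndre {w wu wv : ℕ → ℕ} {k k' m : ℕ} (h : Glue w wu wv k k' m)
    (R : ℕ → ℕ → Prop) :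
    WordAndre R w (k + 1 + k') ↔ WordAndre R wu k ∧ WordAndre R wv k' ∧
      (1 ≤ k → ∃ b, (1 ≤ b ∧ b ≤ k') ∧ ∀ a, 1 ≤ a → a ≤ k → R (wu a) (wv b)) := by
  constructor
  · intro H
    refine ⟨fun i h1 hi ha => ?_, fun i h1 hi ha => ?_, fun hk => ?_⟩
    · obtain ⟨b, hb, hR⟩ := H i h1 (by omega) (by simpa only [h.inLam_left hi] using ha)
      rw [h.inRho_left h1 hi] at hb
      refine ⟨b, hb, fun a ha => ?_⟩
      have := hR a ((h.inLam_left hi a).2 ha)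
      rwa [h.left a (by have := ha.2.1; omega), h.left b hb.2.1] at this
    · obtain ⟨a, ha⟩ := ha
      obtain ⟨b, hb, hR⟩ := H (k + 1 + i) (by omega) (by omega)
        ⟨_, (h.inLam_right h1 hi _).2 ⟨a, rfl, ha⟩⟩
      obtain ⟨b, rfl, hb'⟩ := (h.inRho_right h1 _).1 hb
      refine ⟨b, hb', fun a ha => ?_⟩
      have := hR _ ((h.inLam_right h1 hi _).2 ⟨a, rfl, ha⟩)
      rwa [h.right a ha.1, h.right b (by have := hb'.1; omega)] at this
    · obtain ⟨b, hb, hR⟩ := H (k + 1) (by omega) (by omega)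
        ⟨1, (h.inLam_mid 1).2 ⟨le_rfl, hk⟩⟩
      rw [h.inRho_mid] at hb
      obtain ⟨b, rfl⟩ := Nat.exists_eq_add_of_le hb.1.le
      refine ⟨b, by omega, fun a h1 ha => ?_⟩
      have := hR a ((h.inLam_mid a).2 ⟨h1, ha⟩)
      rwa [h.left a ha, h.right b (by omega)] at this
  · rintro ⟨hu, hv, hm⟩ i h1 hi ⟨a, ha⟩
    rcases lt_trichotomy i (k + 1) with hik | rfl | hik
    · have hik : i ≤ k := by omega
      obtain ⟨b, hb, hR⟩ := hu i h1 hik ⟨a, (h.inLam_left hik a).1 ha⟩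
      refine ⟨b, (h.inRho_left h1 hik b).2 hb, fun a ha => ?_⟩
      rw [h.left a (by have := ha.2.1; omega), h.left b hb.2.1]
      exact hR a ((h.inLam_left hik a).1 ha)
    · rw [h.inLam_mid] at ha
      obtain ⟨b, hb, hR⟩ := hm (by omega)
      refine ⟨k + 1 + b, (h.inRho_mid _).2 (by omega), fun a ha => ?_⟩
      rw [h.inLam_mid] at ha
      rw [h.left a ha.2, h.right b hb.1]
      exact hR a ha.1 ha.2
    · obtain ⟨i, rfl⟩ := Nat.exists_eq_add_of_le hik.le
      have hi1 : 1 ≤ i := by omega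
      have hi' : i ≤ k' := by omega
      obtain ⟨a, rfl, ha'⟩ := (h.inLam_right hi1 hi' _).1 ha
      obtain ⟨b, hb, hR⟩ := hv i hi1 hi' ⟨a, ha'⟩
      refine ⟨k + 1 + b, (h.inRho_right hi1 _).2 ⟨b, rfl, hb⟩, fun a ha => ?_⟩
      obtain ⟨a, rfl, ha'⟩ := (h.inLam_right hi1 hi' _).1 ha
      rw [h.right a ha'.1, h.right b (by have := hb.1; omega)]
      exact hR a ha'

theorem letter_zero (l : List ℕ) : letter l 0 = 0 := rfl

theorem letter_of_length_lt {l : List ℕ} {i : ℕ} (h : l.length < i) : letter l i = 0 := by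
  rw [letter, if_neg (by omega), List.getD_eq_default _ _ (by omega)]

theorem mem_iff_letter {l : List ℕ} {a : ℕ} :
    a ∈ l ↔ ∃ i, 1 ≤ i ∧ i ≤ l.length ∧ letter l i = a := by
  rw [List.mem_iff_getElem]
  constructor
  · rintro ⟨i, hi, rfl⟩
    exact ⟨i + 1, by omega, by omega, by simp [letter, hi]⟩
  · rintro ⟨i, h1, hi, rfl⟩
    have : i - 1 < l.length := by omega
    exact ⟨i - 1, this, by simp [letter, this, show i ≠ 0 by omega]⟩

theorem letter_mem {l : List ℕ} {i : ℕ} (h1 : 1 ≤ i) (hi : i ≤ l.length) : letter l i ∈ l :=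
  mem_iff_letter.2 ⟨i, h1, hi, rfl⟩

theorem glue_letter {u v : List ℕ} {m : ℕ} (hu : ∀ a ∈ u, m < a) (hv : ∀ a ∈ v, m < a) :
    Glue (letter (u ++ m :: v)) (letter u) (letter v) u.length v.length m where
  left i hi := by
    rcases Nat.eq_zero_or_pos i with rfl | h
    · rfl
    · simp only [letter, if_neg h.ne']
      exact List.getD_append _ _ _ _ (by omega)
  mid := by simp [letter]
  right j hj := by
    simp only [letter, if_neg (show j ≠ 0 by omega), if_neg (show u.length + 1 + j ≠ 0 by omega)]
    rw [List.getD_append_right _ _ _ _ (by omega),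
      show u.length + 1 + j - 1 - u.length = (j - 1) + 1 by omega, List.getD_cons_succ]
  lt_left i h1 hi := hu _ (letter_mem h1 hi)
  lt_right i h1 hi := hv _ (letter_mem h1 hi)
  left_zero := rfl
  right_zero := rfl
  right_end := letter_of_length_lt (by omega)

def listAndre (R : ℕ → ℕ → Prop) (l : List ℕ) : Prop := WordAndre R (letter l) l.length

/-- The triple statistic (des, rminda, rmin) of a word. -/
def listStat (l : List ℕ) : ℕ × ℕ × ℕ :=
  (wordDes (letter l) l.length, wordRminda (letter l) l.length, wordRmin (letter l) l.length)

theorem listAndre_nil (R : ℕ → ℕ → Prop) : listAndre R [] := by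
  intro i h1 hi
  simp at hi
  omega

theorem listAndre_append_cons {R : ℕ → ℕ → Prop} {u v : List ℕ} {m : ℕ}
    (hu : ∀ a ∈ u, m < a) (hv : ∀ a ∈ v, m < a) :
    listAndre R (u ++ m :: v) ↔ listAndre R u ∧ listAndre R v ∧
      (u ≠ [] → ∃ b ∈ v, ∀ a ∈ u, R a b) := by
  have hl : (u ++ m :: v).length = u.length + 1 + v.length := by simp; omega
  unfold listAndre
  rw [hl, (glue_letter hu hv).wordAndre]
  refine and_congr_right fun _ => and_congr_right fun _ => imp_congr ?_ ?_
  · rw [← List.length_pos_iff]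
    rfl
  · constructor
    · rintro ⟨b, hb, hR⟩
      refine ⟨_, letter_mem hb.1 hb.2, fun a ha => ?_⟩
      obtain ⟨i, h1, hi, rfl⟩ := mem_iff_letter.1 ha
      exact hR i h1 hi
    · rintro ⟨b, hb, hR⟩
      obtain ⟨i, h1, hi, rfl⟩ := mem_iff_letter.1 hb
      exact ⟨i, ⟨h1, hi⟩, fun a h1 ha => hR _ (letter_mem h1 ha)⟩

theorem listStat_append_cons {u v : List ℕ} {m : ℕ} (hm : 0 < m)
    (hu : ∀ a ∈ u, m < a) (hv : ∀ a ∈ v, m < a) :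
    listStat (u ++ m :: v) =
      ((listStat u).1 + (if u.length = 0 then 0 else 1) + (listStat v).1,
        (if u.length = 0 ∧ v.length ≠ 0 then 1 else 0) + (listStat v).2.1,
        1 + (listStat v).2.2) := by
  have hl : (u ++ m :: v).length = u.length + 1 + v.length := by simp; omega
  have h := glue_letter hu hv
  simp only [listStat, hl, h.wordDes, h.wordRminda hm, h.wordRmin]

/-- André words (for the relation `R`) whose letters are the elements of `S`, each used once. -/
def AndreWord (R : ℕ → ℕ → Prop) (S : Finset ℕ) : Type :=
  {l : List ℕ // l.Nodup ∧ l.toFinset = S ∧ listAndre R l}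

namespace AndreWord

variable {R : ℕ → ℕ → Prop} {S : Finset ℕ}

theorem mem_iff (l : AndreWord R S) {a : ℕ} : a ∈ l.1 ↔ a ∈ S := by
  rw [← List.mem_toFinset, l.2.2.1]

theorem length_eq (l : AndreWord R S) : l.1.length = S.card := by
  rw [← List.toFinset_card_of_nodup l.2.1, l.2.2.1]

/-- Concatenate two André words around a smaller letter, where the second one contains a letter
dominating all letters of the first. -/
def join {U V : Finset ℕ} {m c : ℕ} (hU : ∀ a ∈ U, m < a) (hV : ∀ a ∈ V, m < a)
    (hd : Disjoint U V) (hS : insert m (U ∪ V) = S) (hc : c ∈ V) (hR : ∀ a ∈ U, R a c)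
    (u : AndreWord R U) (v : AndreWord R V) : AndreWord R S := by
  refine ⟨u.1 ++ m :: v.1, ?_, ?_, ?_⟩
  · rw [List.nodup_append, List.nodup_cons]
    refine ⟨u.2.1, ⟨fun h => (hV m (v.mem_iff.1 h)).false, v.2.1⟩, fun a ha b hb => ?_⟩
    rw [u.mem_iff] at ha
    rw [List.mem_cons, v.mem_iff] at hb
    rcases hb with rfl | hb
    · exact (hU a ha).ne'
    · exact Finset.disjoint_iff_ne.1 hd a ha b hb
  · rw [List.toFinset_append, List.toFinset_cons, u.2.2.1, v.2.2.1, ← hS, Finset.union_insert]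
  · rw [listAndre_append_cons (fun a ha => hU a (u.mem_iff.1 ha))
      (fun a ha => hV a (v.mem_iff.1 ha))]
    exact ⟨u.2.2.2, v.2.2.2, fun _ => ⟨c, v.mem_iff.2 hc, fun a ha => hR a (u.mem_iff.1 ha)⟩⟩

/-- `c` dominates all letters of `S` but the least one `m`. -/
structure IsTop (R : ℕ → ℕ → Prop) (S : Finset ℕ) (m c : ℕ) : Prop where
  pos : 0 < m
  mem : m ∈ S
  lt : ∀ a ∈ S, a ≠ m → m < a
  top_mem : c ∈ S.erase m
  top : ∀ a ∈ (S.erase m).erase c, R a c ∧ ¬ R c a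

/-- The subset of `S` underlying a set of elements of `(S.erase m).erase c`. -/
abbrev lower {m c : ℕ} (W : Finset ((S.erase m).erase c)) : Finset ℕ :=
  W.map (Function.Embedding.subtype _)

/-- The complement of `lower W` in `S.erase m`. -/
abbrev upper {m c : ℕ} (W : Finset ((S.erase m).erase c)) : Finset ℕ := S.erase m \ lower W

section

variable {m c : ℕ}

theorem mem_of_mem_lower {W : Finset ((S.erase m).erase c)} {a : ℕ} (ha : a ∈ lower W) :
    a ∈ (S.erase m).erase c :=
  Finset.property_of_mem_map_subtype W ha

theorem IsTop.lt_lower (h : IsTop R S m c) {W : Finset ((S.erase m).erase c)} :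
    ∀ a ∈ lower W, m < a := fun a ha => by
  have := mem_of_mem_lower ha
  simp only [Finset.mem_erase] at this
  exact h.lt a this.2.2 this.2.1

theorem IsTop.lt_upper (h : IsTop R S m c) {W : Finset ((S.erase m).erase c)} :
    ∀ a ∈ upper W, m < a := fun a ha => by
  have := (Finset.mem_sdiff.1 ha).1
  rw [Finset.mem_erase] at this
  exact h.lt a this.2 this.1

/-- Assemble an André word from the factors around its least letter. -/
def assemble (h : IsTop R S m c)
    (x : Σ W : Finset ((S.erase m).erase c), AndreWord R (lower W) × AndreWord R (upper W)) :
    AndreWord R S :=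
  join (c := c) h.lt_lower h.lt_upper Finset.disjoint_sdiff
    (by
      rw [Finset.union_sdiff_of_subset, Finset.insert_erase h.mem]
      exact fun a ha => Finset.mem_of_mem_erase (mem_of_mem_lower ha))
    (Finset.mem_sdiff.2 ⟨h.top_mem, fun hc => Finset.notMem_erase _ _ (mem_of_mem_lower hc)⟩)
    (fun a ha => (h.top a (mem_of_mem_lower ha)).1) x.2.1 x.2.2

theorem assemble_val (h : IsTop R S m c)
    (x : Σ W : Finset ((S.erase m).erase c), AndreWord R (lower W) × AndreWord R (upper W)) :
    (assemble h x).1 = x.2.1.1 ++ m :: x.2.2.1 := rfl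

theorem assemble_injective (h : IsTop R S m c) : Function.Injective (assemble h) := by
  rintro ⟨W, u, v⟩ ⟨W', u', v'⟩ hx
  have hx := congrArg Subtype.val hx
  simp only [assemble_val] at hx
  have hu : m ∉ u.1 := fun hm => (h.lt_lower m (u.mem_iff.1 hm)).false
  have hl : u.1 = u'.1 ∧ v.1 = v'.1 := by
    have hv : m ∉ v.1 := fun hm => (h.lt_upper m (v.mem_iff.1 hm)).false
    exact ((List.append_cons_inj_of_notMem hu hv).1 hx).imp_right And.right
  have hW : W = W' := by
    have := congrArg List.toFinset hl.1
    rw [u.2.2.1, u'.2.2.1] at this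
    exact Finset.map_injective _ this
  subst hW
  have h1 : u = u' := Subtype.ext hl.1
  have h2 : v = v' := Subtype.ext hl.2
  rw [h1, h2]

theorem assemble_surjective (h : IsTop R S m c) : Function.Surjective (assemble h) := by
  intro l
  obtain ⟨u, v, huv⟩ := List.append_of_mem (l.mem_iff.2 h.mem)
  obtain ⟨hn, hS, hA⟩ := l.2
  rw [huv] at hn hS hA
  rw [List.nodup_append, List.nodup_cons] at hn
  obtain ⟨hnu, ⟨hmv, hnv⟩, hd⟩ := hn
  have hmu : m ∉ u := fun hm => hd m hm m (by simp) rfl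
  have hmem : ∀ a, a ∈ S ↔ a ∈ u ∨ a = m ∨ a ∈ v := fun a => by
    rw [← hS]
    simp [or_left_comm]
  have hu : ∀ a ∈ u, m < a := fun a ha =>
    h.lt a ((hmem a).2 (Or.inl ha)) (fun e => hmu (e ▸ ha))
  have hv : ∀ a ∈ v, m < a := fun a ha =>
    h.lt a ((hmem a).2 (Or.inr (Or.inr ha))) (fun e => hmv (e ▸ ha))
  rw [listAndre_append_cons hu hv] at hA
  obtain ⟨hAu, hAv, hR⟩ := hA
  have hcu : c ∉ u := by
    intro hc
    obtain ⟨b, hb, hR⟩ := hR (List.ne_nil_of_mem hc)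
    refine (h.top b ?_).2 (hR c hc)
    simp only [Finset.mem_erase]
    exact ⟨fun e => hd c hc b (by simp [hb]) e.symm, (hv b hb).ne', (hmem b).2 (by simp [hb])⟩
  have hlow : lower (Finset.subtype (· ∈ (S.erase m).erase c) u.toFinset) = u.toFinset := by
    apply Finset.subtype_map_of_mem
    intro a ha
    rw [List.mem_toFinset] at ha
    simp only [Finset.mem_erase]
    exact ⟨fun e => hcu (e ▸ ha), (hu a ha).ne', (hmem a).2 (by simp [ha])⟩
  have hup : upper (Finset.subtype (· ∈ (S.erase m).erase c) u.toFinset) = v.toFinset := by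
    rw [upper, hlow]
    ext a
    simp only [Finset.mem_sdiff, Finset.mem_erase, List.mem_toFinset, hmem]
    constructor
    · tauto
    · exact fun ha => ⟨⟨(hv a ha).ne', by tauto⟩, fun ha' => hd a ha' a (by simp [ha]) rfl⟩
  exact ⟨⟨_, ⟨u, hnu, hlow.symm, hAu⟩, ⟨v, hnv, hup.symm, hAv⟩⟩, Subtype.ext huv.symm⟩

/-- The factorization of André words around the least letter. -/
def assembleEquiv (h : IsTop R S m c) :
    (Σ W : Finset ((S.erase m).erase c), AndreWord R (lower W) × AndreWord R (upper W)) ≃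
      AndreWord R S :=
  Equiv.ofBijective _ ⟨assemble_injective h, assemble_surjective h⟩

theorem listStat_assemble (h : IsTop R S m c) (W : Finset ((S.erase m).erase c))
    (u : AndreWord R (lower W)) (v : AndreWord R (upper W)) :
    listStat (assembleEquiv h ⟨W, u, v⟩).1 =
      ((listStat u.1).1 + (if (lower W).card = 0 then 0 else 1) + (listStat v.1).1,
        (if (lower W).card = 0 ∧ (upper W).card ≠ 0 then 1 else 0) + (listStat v.1).2.1,
        1 + (listStat v.1).2.2) := by
  rw [← u.length_eq, ← v.length_eq]
  exact listStat_append_cons h.pos (fun a ha => h.lt_lower a (u.mem_iff.1 ha))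
    (fun a ha => h.lt_upper a (v.mem_iff.1 ha))

theorem card_upper (W : Finset ((S.erase m).erase c)) :
    (upper W).card = (S.erase m).card - W.card := by
  rw [upper, Finset.card_sdiff_of_subset, Finset.card_map]
  exact fun a ha => Finset.mem_of_mem_erase (mem_of_mem_lower ha)

end

theorem eq_singleton {m : ℕ} (l : AndreWord R {m}) : l.1 = [m] := by
  obtain ⟨a, ha⟩ := List.length_eq_one_iff.1 (l.length_eq.trans (Finset.card_singleton m))
  have := (l.mem_iff (a := a)).1 (by simp [ha])
  rw [ha, Finset.mem_singleton.1 this]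

theorem eq_nil (l : AndreWord R ∅) : l.1 = [] :=
  List.length_eq_zero_iff.1 l.length_eq

/-- There is a unique André word on one letter. -/
abbrev uniqueSingleton (R : ℕ → ℕ → Prop) (m : ℕ) : Unique (AndreWord R {m}) where
  default := ⟨[m], by simp, by simp,
    (listAndre_append_cons (u := []) (v := []) (m := m) (by simp) (by simp)).2
      ⟨listAndre_nil R, listAndre_nil R, fun h => (h rfl).elim⟩⟩
  uniq l := Subtype.ext l.eq_singleton

/-- There is a unique empty André word. -/
abbrev uniqueEmpty (R : ℕ → ℕ → Prop) : Unique (AndreWord R ∅) where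
  default := ⟨[], by simp, by simp, listAndre_nil R⟩
  uniq l := Subtype.ext l.eq_nil

theorem exists_isTop_lt {S : Finset ℕ} (hS : 2 ≤ S.card) (hpos : ∀ a ∈ S, 0 < a) :
    ∃ m c, IsTop (· < ·) S m c := by
  have hne : S.Nonempty := Finset.card_pos.1 (by omega)
  have hm := S.min'_mem hne
  have hne' : (S.erase (S.min' hne)).Nonempty := by
    rw [← Finset.card_pos, Finset.card_erase_of_mem hm]
    omega
  refine ⟨S.min' hne, (S.erase (S.min' hne)).max' hne', hpos _ hm, hm, fun a ha h => ?_,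
    Finset.max'_mem _ _, fun a ha => ?_⟩
  · exact lt_of_le_of_ne (S.min'_le a ha) h.symm
  · rw [Finset.mem_erase] at ha
    have := Finset.le_max' _ a ha.2
    have := ha.1
    omega

theorem exists_isTop_gt {S : Finset ℕ} (hS : 2 ≤ S.card) (hpos : ∀ a ∈ S, 0 < a) :
    ∃ m c, IsTop (· > ·) S m c := by
  have hne : S.Nonempty := Finset.card_pos.1 (by omega)
  have hm := S.min'_mem hne
  have hne' : (S.erase (S.min' hne)).Nonempty := by
    rw [← Finset.card_pos, Finset.card_erase_of_mem hm]
    omega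
  refine ⟨S.min' hne, (S.erase (S.min' hne)).min' hne', hpos _ hm, hm, fun a ha h => ?_,
    Finset.min'_mem _ _, fun a ha => ?_⟩
  · exact lt_of_le_of_ne (S.min'_le a ha) h.symm
  · rw [Finset.mem_erase] at ha
    have := Finset.min'_le _ a ha.2
    have := ha.1
    omega

theorem exists_equiv (k : ℕ) : ∀ S T : Finset ℕ, S.card = k → T.card = k →
    (∀ a ∈ S, 0 < a) → (∀ a ∈ T, 0 < a) →
    ∃ e : AndreWord (· < ·) S ≃ AndreWord (· > ·) T, ∀ l, listStat (e l).1 = listStat l.1 := by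
  induction k using Nat.strong_induction_on with
  | _ k ih =>
  intro S T hS hT hSpos hTpos
  rcases Nat.lt_or_ge k 2 with hk | hk
  · obtain rfl | rfl : k = 0 ∨ k = 1 := by omega
    · obtain rfl := Finset.card_eq_zero.1 hS
      obtain rfl := Finset.card_eq_zero.1 hT
      let := uniqueEmpty (· < ·)
      let := uniqueEmpty (· > ·)
      refine ⟨Equiv.ofUnique _ _, fun l => ?_⟩
      rw [eq_nil, eq_nil]
    · obtain ⟨a, rfl⟩ := Finset.card_eq_one.1 hS
      obtain ⟨b, rfl⟩ := Finset.card_eq_one.1 hT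
      let := uniqueSingleton (· < ·) a
      let := uniqueSingleton (· > ·) b
      refine ⟨Equiv.ofUnique _ _, fun l => ?_⟩
      rw [eq_singleton, eq_singleton,
        ← List.nil_append [b], listStat_append_cons (hTpos b (by simp)) (by simp) (by simp),
        ← List.nil_append [a], listStat_append_cons (hSpos a (by simp)) (by simp) (by simp)]
  · obtain ⟨m, c, h⟩ := exists_isTop_lt (hS ▸ hk) hSpos
    obtain ⟨m', c', h'⟩ := exists_isTop_gt (hT ▸ hk) hTpos
    have hSm : (S.erase m).card = k - 1 := by rw [Finset.card_erase_of_mem h.mem, hS]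
    have hTm : (T.erase m').card = k - 1 := by rw [Finset.card_erase_of_mem h'.mem, hT]
    let e₀ : (S.erase m).erase c ≃ (T.erase m').erase c' := Finset.equivOfCardEq (by
      rw [Finset.card_erase_of_mem h.top_mem, Finset.card_erase_of_mem h'.top_mem, hSm, hTm])
    let e₁ := e₀.finsetCongr
    have he₁ (W) : (e₁ W).card = W.card := Finset.card_map _
    have hcard (W : Finset ((S.erase m).erase c)) : W.card < k := by
      have := Finset.card_le_univ W
      rw [Fintype.card_coe, Finset.card_erase_of_mem h.top_mem] at this
      omega
    have hlow (W : Finset ((S.erase m).erase c)) := ih W.card (hcard W) (lower W) (lower (e₁ W))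
      (Finset.card_map _) ((Finset.card_map _).trans (he₁ W))
      (fun a ha => h.pos.trans (h.lt_lower a ha)) (fun a ha => h'.pos.trans (h'.lt_lower a ha))
    have hup (W : Finset ((S.erase m).erase c)) := ih (k - 1 - W.card) (by omega)
      (upper W) (upper (e₁ W))
      (by rw [card_upper, hSm]) (by rw [card_upper, hTm, he₁])
      (fun a ha => h.pos.trans (h.lt_upper a ha)) (fun a ha => h'.pos.trans (h'.lt_upper a ha))
    choose f hf using hlow
    choose g hg using hup
    refine ⟨(assembleEquiv h).symm.trans ((Equiv.sigmaCongr e₁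
      fun W => (f W).prodCongr (g W)).trans (assembleEquiv h')), fun l => ?_⟩
    obtain ⟨⟨W, u, v⟩, rfl⟩ := (assembleEquiv h).surjective l
    rw [Equiv.trans_apply, Equiv.symm_apply_apply, listStat_assemble]
    refine (listStat_assemble h' (e₁ W) (f W u) (g W v)).trans ?_
    rw [hf, hg, card_upper, card_upper, hSm, hTm, Finset.card_map, Finset.card_map, he₁]

end AndreWord

/-- The one-line notation of a permutation of `[n]`. -/
def permWord {n : ℕ} (σ : Equiv.Perm (Fin n)) : List ℕ := List.ofFn fun i => (σ i : ℕ) + 1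

theorem length_permWord {n : ℕ} (σ : Equiv.Perm (Fin n)) : (permWord σ).length = n := by
  simp [permWord]

theorem letter_permWord {n : ℕ} (σ : Equiv.Perm (Fin n)) : letter (permWord σ) = wrd σ := by
  funext i
  by_cases h : 1 ≤ i ∧ i ≤ n
  · have : i - 1 < n := by omega
    simp [letter, permWord, wrd, h, this, show i ≠ 0 by omega]
  · rw [wrd, dif_neg h]
    rcases Nat.eq_zero_or_pos i with rfl | h0
    · rfl
    · exact letter_of_length_lt (by rw [length_permWord]; omega)

theorem nodup_permWord {n : ℕ} (σ : Equiv.Perm (Fin n)) : (permWord σ).Nodup := by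
  rw [permWord, List.nodup_ofFn]
  intro i j h
  simpa [Fin.val_inj] using h

theorem toFinset_permWord {n : ℕ} (σ : Equiv.Perm (Fin n)) :
    (permWord σ).toFinset = Finset.Icc 1 n := by
  apply Finset.eq_of_subset_of_card_le
  · intro a ha
    simp only [permWord, List.mem_toFinset, List.mem_ofFn] at ha
    obtain ⟨i, rfl⟩ := ha
    simp
  · rw [List.toFinset_card_of_nodup (nodup_permWord σ), length_permWord]
    simp

theorem permWord_injective {n : ℕ} :
    Function.Injective (permWord : Equiv.Perm (Fin n) → List ℕ) := by
  intro σ τ h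
  ext i
  simpa using congrFun (List.ofFn_injective h) i

theorem exists_permWord_eq {n : ℕ} {l : List ℕ} (hl : l.Nodup)
    (h : l.toFinset = Finset.Icc 1 n) : ∃ σ : Equiv.Perm (Fin n), permWord σ = l := by
  have hn : l.length = n := by
    rw [← List.toFinset_card_of_nodup hl, h]
    simp
  subst hn
  have hmem (i : Fin l.length) : 1 ≤ l[i] ∧ l[i] ≤ l.length := by
    rw [← Finset.mem_Icc, ← h]
    simp
  let f : Fin l.length → Fin l.length := fun i => ⟨l[i] - 1, by have := hmem i; omega⟩
  have hf : Function.Injective f := by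
    intro i j hij
    have h1 := hmem i
    have h2 := hmem j
    have h3 : l[i] - 1 = l[j] - 1 := congrArg Fin.val hij
    exact hl.injective_get (show l[i] = l[j] by omega)
  refine ⟨Equiv.ofBijective f (Finite.injective_iff_bijective.1 hf), ?_⟩
  apply List.ext_getElem (length_permWord _)
  intro i h1 h2
  have := hmem ⟨i, h2⟩
  simp only [Fin.getElem_fin] at this
  simp [permWord, f]
  omega

theorem mem_lamB {n : ℕ} {σ : Equiv.Perm (Fin n)} {i a : ℕ} (hi : i ≤ n) :
    a ∈ lamB σ i ↔ InLam (wrd σ) i a := by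
  simp only [lamB, InLam, Finset.mem_filter, Finset.mem_Icc, Finset.mem_Ico, and_imp]
  constructor
  · rintro ⟨h1, h2, h3⟩
    exact ⟨h1.1, h2, h3⟩
  · rintro ⟨h1, h2, h3⟩
    exact ⟨⟨h1, by omega⟩, h2, h3⟩

theorem mem_rhoB {n : ℕ} {σ : Equiv.Perm (Fin n)} {i b : ℕ} :
    b ∈ rhoB σ i ↔ InRho (wrd σ) n i b := by
  simp only [rhoB, InRho, Finset.mem_filter, Finset.mem_Icc, and_imp, Nat.succ_le_iff]
  constructor
  · rintro ⟨h1, h2, h3⟩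
    exact ⟨h2, h1.2, h3⟩
  · rintro ⟨h1, h2, h3⟩
    exact ⟨⟨by omega, h2⟩, h1, h3⟩

theorem WordAndre.noDd {n : ℕ} {σ : Equiv.Perm (Fin n)} {R : ℕ → ℕ → Prop}
    (h : WordAndre R (wrd σ) n) : NoDd σ := by
  rintro i hi ⟨h1, h2⟩
  rw [Finset.mem_Icc] at hi
  have hi1 : i ≠ 1 := by
    rintro rfl
    simp [wrd] at h1
  obtain ⟨b, hb, -⟩ := h i hi.1 hi.2 ⟨i - 1, by omega, by omega, fun l hl hl' => by
    rwa [show l = i - 1 by omega]⟩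
  have := hb.2.2 (i + 1) (by omega) hb.1
  omega

theorem andre_iff_wordAndre {n : ℕ} (σ : Equiv.Perm (Fin n)) (R : ℕ → ℕ → Prop) :
    (NoDd σ ∧ ∀ i ∈ Finset.Icc 1 n, (rhoB σ i = ∅ → lamB σ i = ∅) ∧
      (lamB σ i ≠ ∅ → rhoB σ i ≠ ∅ → ∃ b ∈ rhoB σ i, ∀ a ∈ lamB σ i, R (wrd σ a) (wrd σ b))) ↔
    WordAndre R (wrd σ) n := by
  constructor
  · rintro ⟨-, h⟩ i h1 hi ⟨a, ha⟩
    obtain ⟨h2, h3⟩ := h i (Finset.mem_Icc.2 ⟨h1, hi⟩)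
    have hl : lamB σ i ≠ ∅ := Finset.ne_empty_of_mem ((mem_lamB hi).2 ha)
    simpa only [mem_lamB hi, mem_rhoB] using h3 hl (mt h2 hl)
  · intro h
    refine ⟨h.noDd, fun i hi => ?_⟩
    rw [Finset.mem_Icc] at hi
    have key (hl : lamB σ i ≠ ∅) :
        ∃ b ∈ rhoB σ i, ∀ a ∈ lamB σ i, R (wrd σ a) (wrd σ b) := by
      obtain ⟨a, ha⟩ := Finset.nonempty_iff_ne_empty.2 hl
      simpa only [mem_lamB hi.2, mem_rhoB] using h i hi.1 hi.2 ⟨a, (mem_lamB hi.2).1 ha⟩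
    refine ⟨fun hr => ?_, fun hl _ => key hl⟩
    by_contra hl
    obtain ⟨b, hb, -⟩ := key hl
    simp [hr] at hb

/-- Passing to one-line notation, for permutations satisfying the André condition. -/
def permWordEquiv {n : ℕ} (R : ℕ → ℕ → Prop) (P : Equiv.Perm (Fin n) → Prop)
    (hP : ∀ σ, P σ ↔ WordAndre R (wrd σ) n) :
    {σ // P σ} ≃ AndreWord R (Finset.Icc 1 n) :=
  Equiv.ofBijective
    (fun σ => ⟨permWord σ.1, nodup_permWord _, toFinset_permWord _, by
      rw [listAndre, letter_permWord, length_permWord]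
      exact (hP _).1 σ.2⟩)
    ⟨fun σ τ h => Subtype.ext (permWord_injective (congrArg Subtype.val h)), fun l => by
      obtain ⟨σ, hσ⟩ := exists_permWord_eq l.2.1 l.2.2.1
      refine ⟨⟨σ, (hP σ).2 ?_⟩, Subtype.ext hσ⟩
      have := l.2.2.2
      rwa [← hσ, listAndre, letter_permWord, length_permWord] at this⟩

theorem listStat_permWord {n : ℕ} (σ : Equiv.Perm (Fin n)) :
    listStat (permWord σ) = (permDes σ, permRminda σ, permRmin σ) := by
  rw [listStat, letter_permWord, length_permWord]
  rfl

/-- There is a bijection from André permutations of the first kind of [n] to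
André permutations of the second kind of [n] preserving (des, rminda, rmin). -/
theorem andre1_equiv_andre2 (n : ℕ) :
    ∃ Φ : {σ : Equiv.Perm (Fin n) // IsAndreX1 σ} ≃ {σ : Equiv.Perm (Fin n) // IsAndreX2 σ},
      ∀ σ : {σ : Equiv.Perm (Fin n) // IsAndreX1 σ},
        permDes (Φ σ).1 = permDes σ.1 ∧
        permRminda (Φ σ).1 = permRminda σ.1 ∧
        permRmin (Φ σ).1 = permRmin σ.1 := by
  obtain ⟨e, he⟩ := AndreWord.exists_equiv n (Finset.Icc 1 n) (Finset.Icc 1 n) (by simp) (by simp)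
    (fun a ha => (Finset.mem_Icc.1 ha).1) (fun a ha => (Finset.mem_Icc.1 ha).1)
  let e₁ := permWordEquiv (n := n) (· < ·) IsAndreX1 fun σ => andre_iff_wordAndre σ _
  let e₂ := permWordEquiv (n := n) (· > ·) IsAndreX2 fun σ => andre_iff_wordAndre σ (· > ·)
  refine ⟨e₁.trans (e.trans e₂.symm), fun σ => ?_⟩
  have h : listStat (permWord (e₂.symm (e (e₁ σ))).1) = listStat (permWord σ.1) := by
    refine Eq.trans ?_ (he (e₁ σ))
    exact congrArg (fun l => listStat l.1) (e₂.apply_symm_apply (e (e₁ σ)))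
  rw [listStat_permWord, listStat_permWord] at h
  simp only [Prod.mk.injEq] at h
  exact h
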